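/- arXiv:2111.03369 — 3 statements merged into one kernel-verified Lean document; each statement's English description precedes it below -/
import Mathlib

section
/- For every positive integer n, the sequence of polynomials (K_q(n,m))_{0 ≤ m ≤ n} is strongly q-log-concave; that is, for all 1 ≤ m ≤ l ≤ n−1, the polynomial K_q(n,m)·K_q(n,l) − K_q(n,m−1)·K_q(n,l+1) has nonnegative coefficients as a polynomial in q. -/
open Polynomial Finset

/-- The Gaussian polynomial `[n m]_q`, as a polynomial in `ℤ[q]`
(it vanishes when `m > n`).  It is defined by the `q`-Pascal recursion
`[n m]_q = [n-1 m-1]_q + q^m [n-1 m]_q`. -/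
noncomputable def gauss : ℕ → ℕ → Polynomial ℤ
  | _, 0 => 1
  | 0, _ + 1 => 0
  | n + 1, m + 1 => gauss n m + X ^ (m + 1) * gauss n (m + 1)

/-- The `q`-Kaplansky number `K_q(n,m) = ((1-q^(n+m))/(1-q^n))·[n m]_q`,
defined as the polynomial `[n-1 m-1]_q + q^m·[n m]_q`. -/
noncomputable def kap (n : ℕ) : ℕ → Polynomial ℤ
  | 0 => 1
  | m + 1 => gauss (n - 1) m + X ^ (m + 1) * gauss n (m + 1)

/-- The number of ones of a (0,1)-sequence. -/
def numOnes {N : ℕ} (w : Fin N → Bool) : ℕ :=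
  (Finset.univ.filter fun i => w i = true).card

/-- The inversion number of a (0,1)-sequence: the number of pairs `(i,j)`
with `i < j`, `w i = 1` and `w j = 0`. -/
def invW {N : ℕ} (w : Fin N → Bool) : ℕ :=
  ((Finset.univ : Finset (Fin N × Fin N)).filter
    fun p => p.1 < p.2 ∧ w p.1 = true ∧ w p.2 = false).card

/-- The major index of a (0,1)-sequence: the sum of the (1-based) positions `i`
with `w_i > w_(i+1)`. -/
def majW {N : ℕ} (w : Fin N → Bool) : ℕ :=
  ∑ i : Fin N,
    if h : (i : ℕ) + 1 < N then
      (if w i = true ∧ w ⟨(i : ℕ) + 1, h⟩ = false then (i : ℕ) + 1 else 0)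
    else 0

def NN (p : Polynomial ℤ) : Prop := ∀ i, 0 ≤ p.coeff i

lemma NN.add {p r : Polynomial ℤ} (hp : NN p) (hr : NN r) : NN (p + r) := fun i => by
  rw [coeff_add]; exact add_nonneg (hp i) (hr i)

lemma NN.mul {p r : Polynomial ℤ} (hp : NN p) (hr : NN r) : NN (p * r) := fun i => by
  rw [coeff_mul]; exact Finset.sum_nonneg fun x _ => mul_nonneg (hp _) (hr _)

lemma NN.X_pow (k : ℕ) : NN (X ^ k) := fun i => by
  rw [coeff_X_pow]; split_ifs <;> norm_num

lemma NN.zero : NN 0 := fun i => by simp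

/-- shifted Gaussian polynomial -/
noncomputable def HH (a : ℕ) : ℕ → Polynomial ℤ
  | 0 => 0
  | k + 1 => gauss a k

lemma gauss_zero (a : ℕ) : gauss a 0 = 1 := by cases a <;> rfl

lemma HH_zero (a : ℕ) : HH a 0 = 0 := rfl

lemma HH_r1 (a k : ℕ) : HH (a + 1) (k + 1) = HH a k + X ^ k * HH a (k + 1) := by
  cases k with
  | zero => simp [HH, gauss_zero]
  | succ k => simp [HH, gauss]

lemma HH_big (a : ℕ) : ∀ k, a + 1 < k → HH a k = 0 := by
  induction a with
  | zero =>
    intro k hk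
    obtain ⟨k, rfl⟩ : ∃ t, k = t + 2 := ⟨k - 2, by omega⟩
    rfl
  | succ a ih =>
    intro k hk
    obtain ⟨k, rfl⟩ : ∃ t, k = t + 1 := ⟨k - 1, by omega⟩
    rw [HH_r1, ih k (by omega), ih (k + 1) (by omega)]; simp

lemma HH_r2 (a : ℕ) : ∀ k e, k + e = a + 1 →
    HH (a + 1) (k + 1) = HH a (k + 1) + X ^ e * HH a k := by
  induction a with
  | zero =>
    intro k e h
    obtain rfl | rfl : k = 0 ∨ k = 1 := by omega
    · simp [HH, gauss_zero]
    · obtain rfl : e = 0 := by omega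
      simp [HH, gauss]
  | succ a ih =>
    intro k e h
    rw [HH_r1]
    rcases k with _ | k
    · simp [HH]
    · rcases e with _ | e
      · rw [HH_big (a + 1) (k + 1 + 1) (by omega)]; simp
      · have h1 := ih k (e + 1) (by omega)
        have h2 := ih (k + 1) e (by omega)
        have h3 := HH_r1 a k
        have h4 := HH_r1 a (k + 1)
        rw [h4]
        have h5 : HH (a + 1) (k + 1 + 1) - HH a (k + 1) = X ^ (k + 1) * HH a (k + 1 + 1) := by
          rw [h4]; ring
        have h6 : HH (a + 1) (k + 1 + 1) - HH a (k + 1 + 1) = X ^ e * HH a (k + 1) := by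
          rw [h2]; ring
        rw [← h4, h2]
        linear_combination h1 - X ^ (e + 1) * h3 - h5 + h2 + (X ^ (k + 1) - 1) * 0

lemma HH_nn (a : ℕ) : ∀ k, NN (HH a k) := by
  induction a with
  | zero =>
    intro k
    rcases k with _ | _ | k
    · exact NN.zero
    · simpa [HH, gauss] using NN.X_pow 0
    · exact NN.zero
  | succ a ih =>
    intro k
    rcases k with _ | k
    · exact NN.zero
    · rw [HH_r1]
      exact (ih k).add ((NN.X_pow k).mul (ih _))

lemma stepQ (a : ℕ)
    (P : ∀ m l j, j + 2 * m ≤ 2 * l + 2 →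
      NN (HH a (m + 1) * HH a (l + 1) - X ^ j * (HH a m * HH a (l + 2)))) :
    ∀ m l j, j + 2 * m ≤ 2 * l + 1 →
      NN (HH a (m + 1) * HH (a + 1) (l + 1) - X ^ j * (HH a m * HH (a + 1) (l + 2))) := by
  intro m l j h
  rcases m with _ | m
  · simpa [HH_zero] using (HH_nn a 1).mul (HH_nn (a + 1) (l + 1))
  by_cases hl : a + 2 < l + 2
  · rw [HH_big (a + 1) (l + 2) (by omega)]
    simpa using (HH_nn a (m + 2)).mul (HH_nn (a + 1) (l + 1))
  obtain ⟨l, rfl⟩ : ∃ t, l = t + 1 := ⟨l - 1, by omega⟩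
  by_cases hj : j + 2 * (m + 1) ≤ 2 * (l + 1)
  · convert (P (m + 1) l j (by omega)).add
      ((NN.X_pow (l + 1)).mul (P (m + 1) (l + 1) (j + 1) (by omega))) using 1
    rw [HH_r1 a (l + 1), HH_r1 a (l + 2)]
    ring
  · obtain ⟨j, rfl⟩ : ∃ t, j = t + 1 := ⟨j - 1, by omega⟩
    obtain ⟨e, he⟩ : ∃ e, (l + 2) + e = a + 1 := ⟨a + 1 - (l + 2), by omega⟩
    convert (P (m + 1) (l + 1) (j + 1) (by omega)).add
      ((NN.X_pow (e + 1)).mul (P (m + 1) l j (by omega))) using 1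
    rw [HH_r2 a (l + 1) (e + 1) (by omega), HH_r2 a (l + 2) e (by omega)]
    ring

lemma stepP (a : ℕ)
    (Q : ∀ m l j, j + 2 * m ≤ 2 * l + 1 →
      NN (HH a (m + 1) * HH (a + 1) (l + 1) - X ^ j * (HH a m * HH (a + 1) (l + 2)))) :
    ∀ m l j, j + 2 * m ≤ 2 * l + 2 →
      NN (HH (a + 1) (m + 1) * HH (a + 1) (l + 1)
        - X ^ j * (HH (a + 1) m * HH (a + 1) (l + 2))) := by
  intro m l j h
  rcases m with _ | m
  · simpa [HH_zero] using (HH_nn (a + 1) 1).mul (HH_nn (a + 1) (l + 1))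
  by_cases hl : a + 2 < l + 2
  · rw [HH_big (a + 1) (l + 2) (by omega)]
    simpa using (HH_nn (a + 1) (m + 2)).mul (HH_nn (a + 1) (l + 1))
  by_cases hj : j + 2 * (m + 1) ≤ 2 * l + 1
  · obtain ⟨e, he⟩ : ∃ e, (m + 1) + e = a + 1 := ⟨a + 1 - (m + 1), by omega⟩
    convert (Q (m + 1) l j (by omega)).add
      ((NN.X_pow e).mul (Q m l (j + 1) (by omega))) using 1
    rw [HH_r2 a (m + 1) e (by omega), HH_r2 a m (e + 1) (by omega)]
    ring
  · rcases j with _ | j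
    · obtain rfl : l = m := by omega
      convert NN.zero using 1
      ring
    · convert (Q m l (j + 1) (by omega)).add
        ((NN.X_pow (m + 1)).mul (Q (m + 1) l j (by omega))) using 1
      rw [HH_r1 a (m + 1), HH_r1 a m]
      ring

lemma allP (a : ℕ) : ∀ m l j, j + 2 * m ≤ 2 * l + 2 →
      NN (HH a (m + 1) * HH a (l + 1) - X ^ j * (HH a m * HH a (l + 2))) := by
  induction a with
  | zero =>
    intro m l j _
    rw [HH_big 0 (l + 2) (by omega)]
    simpa using (HH_nn 0 (m + 1)).mul (HH_nn 0 (l + 1))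
  | succ a ih => exact stepP a (stepQ a ih)

lemma allR (a m l : ℕ) (h : m ≤ l + 1) :
    NN (HH (a + 1) (m + 1) * HH a (l + 1) - HH (a + 1) m * HH a (l + 2)) := by
  rcases m with _ | m
  · simpa [HH_zero] using (HH_nn (a + 1) 1).mul (HH_nn a (l + 1))
  by_cases hl : a + 1 < l + 2
  · rw [HH_big a (l + 2) (by omega)]
    simpa using (HH_nn (a + 1) (m + 2)).mul (HH_nn a (l + 1))
  obtain ⟨e, he⟩ : ∃ e, (m + 1) + e = a + 1 := ⟨a + 1 - (m + 1), by omega⟩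
  convert (allP a (m + 1) l 0 (by omega)).add
    ((NN.X_pow e).mul (allP a m l 1 (by omega))) using 1
  rw [HH_r2 a (m + 1) e (by omega), HH_r2 a m (e + 1) (by omega)]
  ring

lemma kap_eq (a m : ℕ) (h : m ≤ a + 1) :
    kap (a + 1) m = HH (a + 1) (m + 1) + X ^ (a + 1) * HH a m := by
  rcases m with _ | m
  · simp [kap, HH, gauss_zero]
  · have e1 : kap (a + 1) (m + 1) = HH a (m + 1) + X ^ (m + 1) * HH (a + 1) (m + 2) := rfl
    obtain ⟨e, rfl⟩ : ∃ e, a = m + e := ⟨a - m, by omega⟩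
    have h1 := HH_r1 (m + e) (m + 1)
    have h2 := HH_r2 (m + e) (m + 1) e (by omega)
    rw [e1]
    linear_combination X ^ (m + 1) * h2 - h1

/-- For every positive integer `n`, the sequence
`(K_q(n,m))_{0 ≤ m ≤ n}` is strongly `q`-log-concave: for all `1 ≤ m ≤ l ≤ n-1`,
the polynomial `K_q(n,m)·K_q(n,l) - K_q(n,m-1)·K_q(n,l+1)` has nonnegative
coefficients. -/
theorem kaplansky_strong_q_log_concave (n : ℕ) (hn : 1 ≤ n) :
    ∀ m l : ℕ, 1 ≤ m → m ≤ l → l ≤ n - 1 →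
      ∀ i, 0 ≤ (kap n m * kap n l - kap n (m - 1) * kap n (l + 1)).coeff i := by
  obtain ⟨a, rfl⟩ : ∃ a, n = a + 1 := ⟨n - 1, by omega⟩
  intro m l hm hml hl
  obtain ⟨m, rfl⟩ : ∃ t, m = t + 1 := ⟨m - 1, by omega⟩
  obtain ⟨l, rfl⟩ : ∃ t, l = t + 1 := ⟨l - 1, by omega⟩
  have key := ((allP (a + 1) (m + 1) (l + 1) 0 (by omega)).add
    ((NN.X_pow (a + 1)).mul ((stepQ a (allP a) m (l + 1) 0 (by omega)).add
      (allR a (m + 1) l (by omega))))).add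
    ((NN.X_pow (2 * (a + 1))).mul (allP a m l 0 (by omega)))
  change NN _
  rw [Nat.add_sub_cancel, kap_eq a (m + 1) (by omega), kap_eq a (l + 1) (by omega),
    kap_eq a m (by omega), kap_eq a (l + 1 + 1) (by omega)]
  convert key using 1
  ring
end

section
/- For all integers n ≥ 1 and m ≥ 2, the symmetric difference of Gaussian polynomials F_{n,m}(q) = [n+m m]_q − q^n·[n+m−2 m−2]_q equals the q-Kaplansky number K_q(n+m−1, m). -/
open Polynomial Finset

theorem gauss_ss (n m : ℕ) :
    gauss (n + 1) (m + 1) = gauss n m + X ^ (m + 1) * gauss n (m + 1) := by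
  rw [gauss]

theorem gauss_z (n : ℕ) : gauss n 0 = 1 := by
  cases n <;> rw [gauss]

theorem gauss_zs (m : ℕ) : gauss 0 (m + 1) = 0 := by
  rw [gauss]

theorem gauss_vanish (n : ℕ) : ∀ m, n < m → gauss n m = 0 := by
  induction n with
  | zero =>
    intro m hm
    obtain ⟨k, rfl⟩ : ∃ k, m = k + 1 := ⟨m - 1, by omega⟩
    exact gauss_zs k
  | succ n ih =>
    intro m hm
    obtain ⟨k, rfl⟩ : ∃ k, m = k + 1 := ⟨m - 1, by omega⟩
    rw [gauss_ss, ih k (by omega), ih (k + 1) (by omega)]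
    simp

theorem gauss_pascal (N : ℕ) : ∀ k n, n + k = N →
    gauss (N + 1) (k + 1) = gauss N (k + 1) + X ^ n * gauss N k := by
  induction N with
  | zero =>
    intro k n h
    obtain rfl : k = 0 := by omega
    obtain rfl : n = 0 := by omega
    rw [gauss_ss, gauss_zs, gauss_z]
    simp
  | succ N ih =>
    intro k n h
    rcases k with _ | k
    · obtain rfl : n = N + 1 := by omega
      have h1 := ih 0 N (by omega)
      have h2 := gauss_ss N 0
      have h3 := gauss_ss (N + 1) 0
      simp only [gauss_z] at h1 h2 h3 ⊢
      rw [h3]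
      linear_combination X ^ (0 + 1) * h1 - h2
    · have h1 := ih k n (by omega)
      rw [gauss_ss (N + 1) (k + 1)]
      rcases n with _ | n
      · rw [gauss_vanish (N + 1) (k + 1 + 1) (by omega)]
        ring
      · have h2 := ih (k + 1) n (by omega)
        have h3 := gauss_ss N k
        have h4 := gauss_ss N (k + 1)
        linear_combination h1 + X ^ (k + 2) * h2 - h4 - X ^ (n + 1) * h3

/-- For `n ≥ 1` and `m ≥ 2`, the Reiner–Stanton symmetric
difference of Gaussian polynomials `F_(n,m)(q) = [n+m m]_q - q^n·[n+m-2 m-2]_q`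
equals the `q`-Kaplansky number `K_q(n+m-1, m)`. -/
theorem reinerStanton_eq_kaplansky (n m : ℕ) (hn : 1 ≤ n) (hm : 2 ≤ m) :
    gauss (n + m) m - X ^ n * gauss (n + m - 2) (m - 2) = kap (n + m - 1) m := by
  obtain ⟨k, rfl⟩ : ∃ k, m = k + 2 := ⟨m - 2, by omega⟩
  have h := gauss_pascal (n + k) k n rfl
  have e1 : n + (k + 2) - 2 = n + k := by omega
  have e2 : n + (k + 2) - 1 = n + k + 1 := by omega
  have e3 : n + (k + 2) = n + k + 1 + 1 := by omega
  have e4 : k + 2 - 2 = k := by omega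
  have e5 : n + k + 1 - 1 = n + k := by omega
  rw [e1, e2, e3, e4, gauss_ss (n + k + 1) (k + 1), kap, e5]
  linear_combination h
end

section
/- For all integers with 1 ≤ m ≤ l < N, M−m ≥ N−l ≥ 1, and every integer r with 0 ≤ r ≤ M−N+2l−2m+2, the polynomial D_q^r(M,N,m,l) = [M m]_q·[N l]_q − q^r·[M m−1]_q·[N l+1]_q has nonnegative coefficients as a polynomial in q. -/
open Polynomial Finset

/-- Box-indexed Gaussian polynomial. -/
noncomputable def gG (a m : ℕ) : Polynomial ℤ := gauss (a + m) m

lemma gG_zero_right (a : ℕ) : gG a 0 = 1 := by simp [gG, gauss]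

lemma gauss_lt : ∀ n m : ℕ, n < m → gauss n m = 0
  | n, 0, h => by omega
  | 0, m + 1, _ => by simp [gauss]
  | n + 1, m + 1, h => by
    rw [gauss, gauss_lt n m (by omega), gauss_lt n (m + 1) (by omega)]; simp

lemma gG_zero_left (m : ℕ) : gG 0 m = 1 := by
  induction m with
  | zero => exact gG_zero_right 0
  | succ m ih =>
    simp only [gG, zero_add] at *
    rw [gauss, ih, gauss_lt m (m + 1) (by omega)]; simp

lemma gG_p1 (a m : ℕ) : gG (a + 1) (m + 1) = gG (a + 1) m + X ^ (m + 1) * gG a (m + 1) := by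
  unfold gG
  rw [show a + 1 + (m + 1) = (a + 1 + m) + 1 by omega, gauss,
    show a + (m + 1) = a + 1 + m by omega]

lemma gG_p2_aux : ∀ n a m : ℕ, a + m = n →
    gG (a + 1) (m + 1) = gG a (m + 1) + X ^ (a + 1) * gG (a + 1) m := by
  intro n
  induction n using Nat.strong_induction_on with
  | _ n ih =>
    intro a m h
    rcases a with _ | a <;> rcases m with _ | m
    · rw [gG_p1]; simp [gG_zero_left, gG_zero_right]
    · have e1 := gG_p1 0 (m + 1)
      have e2 := ih m (by omega) 0 m (by omega)
      have e3 := gG_p1 0 m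
      simp only [gG_zero_left] at *
      linear_combination e1 + e2 - X * e3
    · have e1 := gG_p1 (a + 1) 0
      have e2 := ih a (by omega) a 0 (by omega)
      have e3 := gG_p1 a 0
      simp only [gG_zero_right] at *
      linear_combination e1 - e3 + X * e2
    · have e1 := gG_p1 (a + 1) (m + 1)
      have e2 := ih (a + 1 + m) (by omega) (a + 1) m (by omega)
      have e3 := ih (a + (m + 1)) (by omega) a (m + 1) (by omega)
      have e4 := gG_p1 a (m + 1)
      have e5 := gG_p1 (a + 1) m
      linear_combination e1 + e2 + X ^ (m + 2) * e3 - e4 - X ^ (a + 2) * e5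

lemma gG_p2 (a m : ℕ) : gG (a + 1) (m + 1) = gG a (m + 1) + X ^ (a + 1) * gG (a + 1) m :=
  gG_p2_aux _ a m rfl

noncomputable def gH (a : ℕ) : ℕ → Polynomial ℤ
  | 0 => 0
  | m + 1 => gG (a + 1) m

noncomputable def gK : ℕ → ℕ → Polynomial ℤ
  | 0, _ => 0
  | b + 1, l => gG b (l + 1)

lemma gH_1 (a m : ℕ) : gH (a + 1) (m + 1) = gH (a + 1) m + X ^ m * gH a (m + 1) := by
  rcases m with _ | m
  · simp [gH, gG_zero_right]
  · simp only [gH]; exact gG_p1 _ _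

lemma gH_2 (a m : ℕ) : gH (a + 1) (m + 1) = gH a (m + 1) + X ^ (a + 2) * gH (a + 1) m := by
  rcases m with _ | m
  · simp [gH, gG_zero_right]
  · simp only [gH]; exact gG_p2 _ _

lemma gK_1 (b l : ℕ) : gK (b + 1) (l + 1) = gK (b + 1) l + X ^ (l + 2) * gK b (l + 1) := by
  rcases b with _ | b
  · simp [gK, gG_zero_left]
  · simp only [gK]; exact gG_p1 _ _

lemma gK_2 (b l : ℕ) : gK (b + 1) (l + 1) = gK b (l + 1) + X ^ b * gK (b + 1) l := by
  rcases b with _ | b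
  · simp [gK, gG_zero_left]
  · simp only [gK]; exact gG_p2 _ _

def nnP (p : Polynomial ℤ) : Prop := ∀ i, 0 ≤ p.coeff i

lemma nnP.add {p q : Polynomial ℤ} (hp : nnP p) (hq : nnP q) : nnP (p + q) := fun i => by
  rw [coeff_add]; exact add_nonneg (hp i) (hq i)

lemma nnP.mul {p q : Polynomial ℤ} (hp : nnP p) (hq : nnP q) : nnP (p * q) := fun i => by
  rw [coeff_mul]; exact Finset.sum_nonneg fun x _ => mul_nonneg (hp _) (hq _)

lemma nnP_X (k : ℕ) : nnP (X ^ k) := fun i => by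
  rw [coeff_X_pow]; split_ifs <;> norm_num

lemma nnP_gauss : ∀ n m : ℕ, nnP (gauss n m)
  | n, 0 => by
    have h := nnP_X 0
    rw [pow_zero] at h
    cases n <;> simpa [gauss] using h
  | 0, m + 1 => by intro i; simp [gauss]
  | n + 1, m + 1 => by
    rw [gauss]; exact (nnP_gauss n m).add ((nnP_X _).mul (nnP_gauss n (m + 1)))

lemma nnP_gG (a m : ℕ) : nnP (gG a m) := nnP_gauss _ _

noncomputable def gD (a m b l r : ℕ) : Polynomial ℤ :=
  gG a m * gG b l - X ^ r * (gH a m * gK b l)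

lemma gD_main : ∀ n a m b l r : ℕ, a + m + b + l = n → b ≤ a + 1 → m ≤ l + 1 →
    r + b + m ≤ a + l + 2 → nnP (gD a m b l r) := by
  intro n
  induction n using Nat.strong_induction_on with
  | _ n ih =>
    intro a m b l r hn hb hm hr
    rcases m with _ | m
    · simpa [gD, gH] using (nnP_gG a 0).mul (nnP_gG b l)
    rcases b with _ | b
    · simpa [gD, gK] using (nnP_gG a (m + 1)).mul (nnP_gG 0 l)
    by_cases hl : m + 1 ≤ l
    · obtain ⟨l, rfl⟩ : ∃ k, l = k + 1 := ⟨l - 1, by omega⟩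
      rcases r with _ | r
      · have e : gD a (m + 1) (b + 1) (l + 1) 0 = gD a (m + 1) (b + 1) l 0
            + X ^ (l + 1) * gD a (m + 1) b (l + 1) 1 := by
          unfold gD; rw [gG_p1 b l, gK_1 b l]; ring
        rw [e]
        exact (ih _ (by omega) _ _ _ _ _ rfl (by omega) (by omega) (by omega)).add
          ((nnP_X _).mul (ih _ (by omega) _ _ _ _ _ rfl (by omega) (by omega) (by omega)))
      · have e : gD a (m + 1) (b + 1) (l + 1) (r + 1) = gD a (m + 1) b (l + 1) (r + 1)
            + X ^ (b + 1) * gD a (m + 1) (b + 1) l r := by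
          unfold gD; rw [gG_p2 b l, gK_2 b l]; ring
        rw [e]
        exact (ih _ (by omega) _ _ _ _ _ rfl (by omega) (by omega) (by omega)).add
          ((nnP_X _).mul (ih _ (by omega) _ _ _ _ _ rfl (by omega) (by omega) (by omega)))
    obtain rfl : l = m := by omega
    by_cases ha : b + 1 ≤ a
    · obtain ⟨a, rfl⟩ : ∃ k, a = k + 1 := ⟨a - 1, by omega⟩
      rcases r with _ | r
      · have e : gD (a + 1) (l + 1) (b + 1) l 0 = gD a (l + 1) (b + 1) l 0
            + X ^ (a + 1) * gD (a + 1) l (b + 1) l 1 := by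
          unfold gD; rw [gG_p2 a l, gH_2 a l]; ring
        rw [e]
        exact (ih _ (by omega) _ _ _ _ _ rfl (by omega) (by omega) (by omega)).add
          ((nnP_X _).mul (ih _ (by omega) _ _ _ _ _ rfl (by omega) (by omega) (by omega)))
      · have e : gD (a + 1) (l + 1) (b + 1) l (r + 1) = gD (a + 1) l (b + 1) l (r + 1)
            + X ^ (l + 1) * gD a (l + 1) (b + 1) l r := by
          unfold gD; rw [gG_p1 a l, gH_1 a l]; ring
        rw [e]
        exact (ih _ (by omega) _ _ _ _ _ rfl (by omega) (by omega) (by omega)).add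
          ((nnP_X _).mul (ih _ (by omega) _ _ _ _ _ rfl (by omega) (by omega) (by omega)))
    obtain rfl : a = b := by omega
    obtain rfl : r = 0 := by omega
    have e : gD a (l + 1) (a + 1) l 0 = 0 := by
      simp only [gD, gH, gK]; ring
    rw [e]; intro i; simp

/-- For `1 ≤ m ≤ l < N`, `M - m ≥ N - l ≥ 1` and
`0 ≤ r ≤ M - N + 2l - 2m + 2`, the polynomial
`D_q^r(M,N,m,l) = [M m]_q·[N l]_q - q^r·[M m-1]_q·[N l+1]_q` has nonnegative
coefficients. -/
theorem gauss_product_difference_shift_nonneg (M N m l r : ℕ)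
    (hm : 1 ≤ m) (hml : m ≤ l) (hlN : l < N)
    (h1 : (1 : ℤ) ≤ (N : ℤ) - l) (h2 : (N : ℤ) - l ≤ (M : ℤ) - m)
    (hr : (r : ℤ) ≤ (M : ℤ) - N + 2 * l - 2 * m + 2) :
    ∀ i, 0 ≤ (gauss M m * gauss N l -
      X ^ r * (gauss M (m - 1) * gauss N (l + 1))).coeff i := by
  obtain ⟨m, rfl⟩ : ∃ k, m = k + 1 := ⟨m - 1, by omega⟩
  obtain ⟨b, rfl⟩ : ∃ b, N = b + 1 + l := ⟨N - l - 1, by omega⟩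
  obtain ⟨a, rfl⟩ : ∃ a, M = a + (m + 1) := ⟨M - (m + 1), by omega⟩
  have h := gD_main _ a (m + 1) (b + 1) l r rfl (by omega) (by omega) (by omega)
  simp only [gD, gH, gK, gG] at h
  rw [show a + 1 + m = a + (m + 1) by omega, show b + (l + 1) = b + 1 + l by omega] at h
  exact h
end
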